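/- arXiv:2601.09128 — 9 statements merged into one kernel-verified Lean document; each statement's English description precedes it below -/
import Mathlib

section
/- Let ι be a finite nonempty type with a distinguished element x₀, let B be a unitary matrix over ℂ indexed by ι, and let ψ = B *ᵥ e_{x₀}, where e_{x₀} is the standard basis vector at x₀. Let X be a finite set of elements of ι and set p = ∑_{x ∈ X} ‖ψ x‖². Assume 0 < p. Set θ = arcsin(√p), let J = ⌊π/(4θ) − 1/2⌋ (a nonnegative integer, since 0 < p ≤ 1 forces 0 < θ ≤ π/2), and let φ = 2·arcsin( sin(π/(4J+6)) / √p ). Define the diagonal matrices R_f = diagonal(x ↦ if x ∈ X then exp(iφ) else 1) and R₀ = diagonal(x ↦ if x = x₀ then exp(iφ) else 1), and the operator EQ = B · R₀ · Bᴴ · R_f (Bᴴ the conjugate transpose). Then the state obtained after J+1 applications of EQ to ψ is exactly supported on the target set: ∑_{x ∈ X} ‖(EQ^{J+1} *ᵥ ψ) x‖² = 1. -/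
open Real Matrix Finset

section UnitaryMulVec

theorem sum_norm_sq_eq_dotProduct {ι : Type*} [Fintype ι] (v : ι → ℂ) :
    ((∑ x, ‖v x‖ ^ 2 : ℝ) : ℂ) = star v ⬝ᵥ v := by
  simp [dotProduct, Complex.conj_mul']

variable {ι : Type*} [Fintype ι] [DecidableEq ι]

theorem sum_norm_sq_mulVec_of_mem_unitaryGroup {U : Matrix ι ι ℂ}
    (hU : U ∈ Matrix.unitaryGroup ι ℂ) (v : ι → ℂ) :
    ∑ x, ‖(U *ᵥ v) x‖ ^ 2 = ∑ x, ‖v x‖ ^ 2 := by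
  have h : Uᴴ * U = 1 := Matrix.mem_unitaryGroup_iff'.mp hU
  have key : ((∑ x, ‖(U *ᵥ v) x‖ ^ 2 : ℝ) : ℂ) = ((∑ x, ‖v x‖ ^ 2 : ℝ) : ℂ) := by
    rw [sum_norm_sq_eq_dotProduct, sum_norm_sq_eq_dotProduct, star_mulVec,
      ← dotProduct_mulVec, mulVec_mulVec, h, one_mulVec]
  exact_mod_cast key

theorem diagonal_mem_unitaryGroup {d : ι → ℂ} (hd : ∀ x, ‖d x‖ = 1) :
    Matrix.diagonal d ∈ Matrix.unitaryGroup ι ℂ := by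
  rw [Matrix.mem_unitaryGroup_iff, star_eq_conjTranspose, diagonal_conjTranspose,
    diagonal_mul_diagonal, ← diagonal_one]
  congr 1
  ext x
  simp [Complex.mul_conj', hd x]

/-- Conjugating a phase rotation about a basis vector by a unitary gives the phase rotation about
the image of that vector. -/
theorem conj_phase_mulVec {B : Matrix ι ι ℂ} (hB : B ∈ Matrix.unitaryGroup ι ℂ) (x₀ : ι)
    (ω : ℂ) (v : ι → ℂ) :
    (B * Matrix.diagonal (fun x => if x = x₀ then ω else 1) * Bᴴ) *ᵥ v =
      v + ((ω - 1) * (star (B *ᵥ Pi.single x₀ 1) ⬝ᵥ v)) • (B *ᵥ Pi.single x₀ 1) := by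
  have h : B * Bᴴ = 1 := Matrix.mem_unitaryGroup_iff.mp hB
  have hdiag (w : ι → ℂ) : Matrix.diagonal (fun x => if x = x₀ then ω else 1) *ᵥ w =
      w + ((ω - 1) * w x₀) • Pi.single x₀ 1 := by
    ext x
    rw [mulVec_diagonal]
    by_cases hx : x = x₀
    · subst hx
      simp
      ring
    · simp [hx]
  have hcoord : (Bᴴ *ᵥ v) x₀ = star (B *ᵥ Pi.single x₀ 1) ⬝ᵥ v := by
    simp [mulVec, dotProduct, conjTranspose_apply]
  rw [← mulVec_mulVec, ← mulVec_mulVec, hdiag, mulVec_add, mulVec_smul, mulVec_mulVec, h,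
    one_mulVec, hcoord]

end UnitaryMulVec

theorem Complex.exp_two_mul_I_sub_one_sq (a : ℂ) :
    (Complex.exp (2 * a * Complex.I) - 1) ^ 2 =
      -4 * Complex.exp (2 * a * Complex.I) * Complex.sin a ^ 2 := by
  have h2 : Complex.exp (2 * a * Complex.I) = Complex.exp (a * Complex.I) ^ 2 := by
    rw [← Complex.exp_nat_mul]
    congr 1
    push_cast
    ring
  have h3 : Complex.exp (a * Complex.I) * Complex.exp (-a * Complex.I) = 1 := by
    rw [← Complex.exp_add]
    simp
  rw [h2, Complex.sin]
  linear_combination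
    (2 * Complex.exp (a * Complex.I) ^ 2 - 1 -
      Complex.exp (a * Complex.I) * Complex.exp (-a * Complex.I)) * h3 +
    Complex.exp (a * Complex.I) ^ 2 *
      (Complex.exp (-a * Complex.I) - Complex.exp (a * Complex.I)) ^ 2 * Complex.I_sq

theorem pi_div_le_of_floor {θ : ℝ} (hθ : 0 < θ) {J : ℕ}
    (hJ : (J : ℤ) = ⌊π / (4 * θ) - 1 / 2⌋) : π / (4 * J + 6) ≤ θ := by
  have h1 := Int.lt_floor_add_one (π / (4 * θ) - 1 / 2)
  rw [← hJ] at h1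
  push_cast at h1
  have h2 : π / (4 * θ) < J + 3 / 2 := by linarith
  rw [div_lt_iff₀ (by positivity)] at h2
  rw [div_le_iff₀ (by positivity)]
  linarith

/-- The amplitude outside the target set after `n` rounds of amplification, where the phase `ω`
and the initial success probability `p` satisfy `p (ω - 1)² = -4 ω sin² γ`. -/
theorem amplification_pow_mulVec {ι : Type*} [Fintype ι] [DecidableEq ι] {ψ : ι → ℂ}
    {X : Finset ι} {p ω γ : ℂ} {Q : Matrix ι ι ℂ} (hω : p * (ω - 1) ^ 2 = -4 * ω * Complex.sin γ ^ 2)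
    (hQ : ∀ α β : ℂ, Q *ᵥ (fun x => (if x ∈ X then α else β) * ψ x) = fun x =>
      (if x ∈ X then ω * α + (ω - 1) * (ω * α * p + β * (1 - p))
        else β + (ω - 1) * (ω * α * p + β * (1 - p))) * ψ x) (n : ℕ) :
    ∃ α β : ℂ, (Q ^ n) *ᵥ ψ = (fun x => (if x ∈ X then α else β) * ψ x) ∧
      β * Complex.cos γ = ω ^ n * Complex.cos ((2 * n + 1) * γ) ∧
      (β + (ω - 1) * (ω * α * p + β * (1 - p))) * Complex.cos γ =
        ω ^ (n + 1) * Complex.cos ((2 * n + 3) * γ) := by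
  have hsc := Complex.sin_sq_add_cos_sq γ
  induction n with
  | zero =>
    refine ⟨1, 1, by simp, by simp, ?_⟩
    simp only [Nat.cast_zero, mul_zero, zero_add, pow_one, Complex.cos_three_mul]
    linear_combination Complex.cos γ * hω - 4 * ω * Complex.cos γ * hsc
  | succ n ih =>
    obtain ⟨α, β, hv, h0, h1⟩ := ih
    refine ⟨_, _, by rw [pow_succ', ← mulVec_mulVec, hv, hQ], ?_, ?_⟩
    · rw [h1]
      push_cast
      ring_nf
    · have hcos : Complex.cos ((2 * n + 5) * γ) =
          2 * (1 - 2 * Complex.sin γ ^ 2) * Complex.cos ((2 * n + 3) * γ) -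
            Complex.cos ((2 * n + 1) * γ) := by
        have e1 : (2 * (n : ℂ) + 5) * γ = (2 * n + 3) * γ + 2 * γ := by ring
        have e2 : (2 * (n : ℂ) + 1) * γ = (2 * n + 3) * γ - 2 * γ := by ring
        rw [e1, e2, Complex.cos_add, Complex.cos_sub, Complex.cos_two_mul]
        linear_combination 4 * Complex.cos ((2 * n + 3) * γ) * hsc
      have e3 : (2 * ((n + 1 : ℕ) : ℂ) + 3) * γ = (2 * n + 5) * γ := by
        push_cast
        ring
      rw [e3, hcos]
      linear_combination (2 * ω * (1 - 2 * Complex.sin γ ^ 2)) * h1 - ω ^ 2 * h0 +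
        (β + (ω - 1) * (ω * α * p + β * (1 - p))) * Complex.cos γ * hω

theorem stmt_0 {ι : Type*} [Fintype ι] [DecidableEq ι] [Nonempty ι] (x₀ : ι)
    (B : Matrix ι ι ℂ) (hB : B ∈ Matrix.unitaryGroup ι ℂ)
    (ψ : ι → ℂ) (hψ : ψ = B.mulVec (Pi.single x₀ 1))
    (X : Finset ι) (p : ℝ) (hp : p = ∑ x ∈ X, ‖ψ x‖ ^ 2) (hp0 : 0 < p)
    (θ : ℝ) (hθ : θ = Real.arcsin (Real.sqrt p))
    (J : ℕ) (hJ : (J : ℤ) = ⌊π / (4 * θ) - 1 / 2⌋)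
    (φ : ℝ) (hφ : φ = 2 * Real.arcsin (Real.sin (π / (4 * J + 6)) / Real.sqrt p))
    (Rf R₀ EQ : Matrix ι ι ℂ)
    (hRf : Rf = Matrix.diagonal (fun x => if x ∈ X then Complex.exp (Complex.I * φ) else 1))
    (hR₀ : R₀ = Matrix.diagonal (fun x => if x = x₀ then Complex.exp (Complex.I * φ) else 1))
    (hEQ : EQ = B * R₀ * Bᴴ * Rf) :
    ∑ x ∈ X, ‖((EQ ^ (J + 1)).mulVec ψ) x‖ ^ 2 = 1 := by
  set γ : ℝ := π / (4 * J + 6) with hγ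
  set ω : ℂ := Complex.exp (Complex.I * φ) with hω
  have hω1 : ‖ω‖ = 1 := by rw [hω, mul_comm, Complex.norm_exp_ofReal_mul_I]
  have hnorm : ∑ x, ‖ψ x‖ ^ 2 = 1 := by
    rw [hψ, sum_norm_sq_mulVec_of_mem_unitaryGroup hB, Finset.sum_eq_single x₀] <;> simp +contextual
  have hp1 : p ≤ 1 := by
    rw [hp, ← hnorm]
    exact Finset.sum_le_univ_sum_of_nonneg fun x => by positivity
  have hsqrt : 0 < √p := Real.sqrt_pos.mpr hp0
  have hsqrt1 : √p ≤ 1 := Real.sqrt_le_one.mpr hp1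
  have hγ0 : 0 < γ := by positivity
  have hγθ : γ ≤ θ := pi_div_le_of_floor (hθ ▸ Real.arcsin_pos.mpr hsqrt) hJ
  have hθ2 : θ ≤ π / 2 := hθ ▸ Real.arcsin_le_pi_div_two _
  have hγ2 : γ < π / 2 := by
    rw [hγ, div_lt_div_iff₀ (by positivity) (by positivity)]
    nlinarith [Real.pi_pos, mul_nonneg Real.pi_pos.le (Nat.cast_nonneg (α := ℝ) J)]
  have hsinγ : Real.sin γ ≤ √p := by
    have h := Real.sin_le_sin_of_le_of_le_pi_div_two (by linarith) hθ2 hγθ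
    rwa [hθ, Real.sin_arcsin (by linarith) hsqrt1] at h
  have hsinφ : p * Real.sin (φ / 2) ^ 2 = Real.sin γ ^ 2 := by
    have hs0 : 0 ≤ Real.sin γ := Real.sin_nonneg_of_nonneg_of_le_pi hγ0.le (by linarith)
    rw [hφ, mul_div_cancel_left₀ _ two_ne_zero, Real.sin_arcsin
      (by linarith [div_nonneg hs0 hsqrt.le]) ((div_le_one hsqrt).mpr hsinγ), div_pow,
      Real.sq_sqrt hp0.le, mul_div_cancel₀ _ hp0.ne']
  have hphase : (p : ℂ) * (ω - 1) ^ 2 = -4 * ω * Complex.sin (γ : ℂ) ^ 2 := by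
    have h1 := Complex.exp_two_mul_I_sub_one_sq ((φ / 2 : ℝ) : ℂ)
    have h2 : 2 * ((φ / 2 : ℝ) : ℂ) * Complex.I = Complex.I * φ := by
      push_cast
      ring
    have h3 : (p : ℂ) * Complex.sin ((φ / 2 : ℝ) : ℂ) ^ 2 = Complex.sin (γ : ℂ) ^ 2 := by
      exact_mod_cast hsinφ
    rw [h2, ← hω] at h1
    linear_combination (p : ℂ) * h1 - 4 * ω * h3
  have hgood : ∑ x ∈ X, star (ψ x) * ψ x = p := by
    simp [hp, Complex.conj_mul']
  have hbad : ∑ x ∈ Xᶜ, star (ψ x) * ψ x = 1 - p := by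
    have h := Finset.sum_add_sum_compl X fun x => star (ψ x) * ψ x
    have h' : ∑ x, star (ψ x) * ψ x = 1 := by
      have := sum_norm_sq_eq_dotProduct ψ
      rw [hnorm] at this
      simpa [dotProduct] using this.symm
    rw [hgood, h'] at h
    linear_combination h
  have hdot (a b : ℂ) : star ψ ⬝ᵥ (fun x => (if x ∈ X then a else b) * ψ x) =
      a * p + b * (1 - p) := by
    rw [dotProduct, ← Finset.sum_add_sum_compl X, ← hbad, ← hgood, Finset.mul_sum,
      Finset.mul_sum]
    congr 1 <;> refine Finset.sum_congr rfl fun x hx => ?_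
    · simp [hx]; ring
    · simp [Finset.mem_compl.mp hx]; ring
  have hstep (α β : ℂ) : EQ *ᵥ (fun x => (if x ∈ X then α else β) * ψ x) = fun x =>
      (if x ∈ X then ω * α + (ω - 1) * (ω * α * p + β * (1 - p))
        else β + (ω - 1) * (ω * α * p + β * (1 - p))) * ψ x := by
    have h : Rf *ᵥ (fun x => (if x ∈ X then α else β) * ψ x) =
        fun x => (if x ∈ X then ω * α else β) * ψ x := by
      ext x
      rw [hRf, mulVec_diagonal]
      split_ifs <;> ring
    rw [hEQ, ← mulVec_mulVec, h, hR₀, conj_phase_mulVec hB, ← hψ, hdot]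
    ext x
    simp only [Pi.add_apply, Pi.smul_apply, smul_eq_mul]
    split_ifs <;> ring
  have hU : EQ ∈ Matrix.unitaryGroup ι ℂ := by
    rw [hEQ, hR₀, hRf]
    refine mul_mem (mul_mem (mul_mem hB (diagonal_mem_unitaryGroup fun x => ?_))
      (Unitary.star_mem hB)) (diagonal_mem_unitaryGroup fun x => ?_) <;>
    split_ifs <;> simp [hω1]
  obtain ⟨α, β, hv, hβ, -⟩ := amplification_pow_mulVec hphase hstep (J + 1)
  have hβ0 : β = 0 := by
    have hangle : (2 * ((J + 1 : ℕ) : ℂ) + 1) * (γ : ℂ) = ((π / 2 : ℝ) : ℂ) := by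
      have : (2 * ((J + 1 : ℕ) : ℝ) + 1) * γ = π / 2 := by
        rw [hγ]
        push_cast
        field_simp
        ring
      exact_mod_cast this
    have hcos : Complex.cos (γ : ℂ) ≠ 0 := by
      exact_mod_cast (Real.cos_pos_of_mem_Ioo ⟨by linarith, hγ2⟩).ne'
    rw [hangle, ← Complex.ofReal_cos (π / 2), Real.cos_pi_div_two, Complex.ofReal_zero, mul_zero] at hβ
    exact (mul_eq_zero.mp hβ).resolve_right hcos
  have htotal := sum_norm_sq_mulVec_of_mem_unitaryGroup (pow_mem hU (J + 1)) ψ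
  rw [hnorm] at htotal
  rw [← htotal]
  refine Finset.sum_subset (Finset.subset_univ X) fun x _ hx => ?_
  simp [hv, hx, hβ0]
end

section
/- Let p ∈ ℝ with 0 < p ≤ 1, set θ = arcsin(√p), let J = ⌊π/(4θ) − 1/2⌋ (a nonnegative integer), and φ = 2·arcsin( sin(π/(4J+6)) / √p ). Let ψ : Fin 2 → ℂ be the vector (sin θ, cos θ), let E₀ be the 2×2 matrix with (0,0)-entry 1 and all other entries 0, and define the 2×2 complex matrix M = (1 + (exp(iφ) − 1) • vecMulVec ψ (star ψ)) · (1 + (exp(iφ) − 1) • E₀), where vecMulVec ψ (star ψ) is the rank-one matrix ψ ψ† and 1 is the identity matrix. Then the second component of M^{J+1} *ᵥ ψ is zero, i.e. (M^{J+1} *ᵥ ψ) 1 = 0 (equivalently, the first component has modulus 1). -/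
open Real Matrix

/-- A phase `φ` with `sin (φ / 2) * s = x` satisfies `(exp (i φ) - 1)² s² = -4 exp (i φ) x²`. -/
lemma exp_sub_one_sq_mul_sq {φ s x : ℝ} (h : Real.sin (φ / 2) * s = x) :
    (Complex.exp (Complex.I * φ) - 1) ^ 2 * (s : ℂ) ^ 2 =
      -4 * Complex.exp (Complex.I * φ) * (x : ℂ) ^ 2 := by
  have hw : Complex.exp (Complex.I * φ) =
      (Complex.cos ((φ / 2 : ℝ) : ℂ) + Complex.sin ((φ / 2 : ℝ) : ℂ) * Complex.I) ^ 2 := by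
    rw [← Complex.exp_mul_I, ← Complex.exp_nat_mul]
    congr 1
    push_cast
    ring
  have hx : (x : ℂ) = Complex.sin ((φ / 2 : ℝ) : ℂ) * s := by
    rw [← h]
    push_cast
    rfl
  have hcs := Complex.sin_sq_add_cos_sq ((φ / 2 : ℝ) : ℂ)
  rw [hw, hx]
  generalize Complex.cos ((φ / 2 : ℝ) : ℂ) = a at *
  generalize Complex.sin ((φ / 2 : ℝ) : ℂ) = b at *
  have h1 : (a + b * Complex.I) ^ 2 - 1 = 2 * b * Complex.I * (a + b * Complex.I) := by
    linear_combination hcs - b ^ 2 * Complex.I_sq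
  rw [h1]
  linear_combination 4 * b ^ 2 * (a + b * Complex.I) ^ 2 * (s : ℂ) ^ 2 * Complex.I_sq

/-- The product of two phase shifts along `(s, c)` and the first coordinate vector acts on the
second coordinate of `(s, c)` as a rotation by `2 α`, up to the phase `w`. -/
lemma cos_mul_pow_mulVec_one {s c w α : ℂ} (hsc : s ^ 2 + c ^ 2 = 1)
    (hw : (w - 1) ^ 2 * s ^ 2 = -4 * w * Complex.sin α ^ 2)
    {M : Matrix (Fin 2) (Fin 2) ℂ}
    (hM : M = (1 + (w - 1) • Matrix.vecMulVec ![s, c] ![s, c]) *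
      (1 + (w - 1) • !![1, 0; 0, 0])) (n : ℕ) :
    Complex.cos α * ((M ^ n).mulVec ![s, c]) 1 =
      w ^ n * c * Complex.cos ((2 * n + 1) * α) := by
  have hM' : M = !![(1 + (w - 1) * s ^ 2) * w, (w - 1) * s * c;
      (w - 1) * s * c * w, 1 + (w - 1) * c ^ 2] := by
    rw [hM]
    ext i j
    fin_cases i <;> fin_cases j <;>
      simp [Matrix.mul_apply, Fin.sum_univ_two, -mul_eq_mul_left_iff, -mul_eq_mul_right_iff,
        -add_right_inj] <;> ring
  have hcos : Complex.cos (2 * α) = 1 - 2 * Complex.sin α ^ 2 := by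
    rw [Complex.cos_two_mul]
    linear_combination 2 * Complex.sin_sq_add_cos_sq α
  have htr : (1 + (w - 1) * s ^ 2) * w + (1 + (w - 1) * c ^ 2) = 2 * w * Complex.cos (2 * α) := by
    rw [hcos]
    linear_combination hw + (w - 1) * hsc
  have hdet : (1 + (w - 1) * s ^ 2) * w * (1 + (w - 1) * c ^ 2) -
      (w - 1) * s * c * ((w - 1) * s * c * w) = w ^ 2 := by
    linear_combination w * (w - 1) * hsc
  have hsq : M * M = (2 * w * Complex.cos (2 * α)) • M - w ^ 2 • (1 : Matrix _ _ ℂ) := by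
    rw [← htr, ← hdet, hM']
    ext i j
    fin_cases i <;> fin_cases j <;> simp [Matrix.mul_apply, Fin.sum_univ_two] <;> ring
  induction n using Nat.twoStepInduction with
  | zero => simp [mul_comm]
  | one =>
    have h3 : Complex.cos ((2 * (1 : ℕ) + 1) * α) =
        Complex.cos α * (1 - 4 * Complex.sin α ^ 2) := by
      have : (2 * ((1 : ℕ) : ℂ) + 1) * α = 3 * α := by push_cast; ring
      rw [this, Complex.cos_three_mul]
      linear_combination 4 * Complex.cos α * Complex.sin_sq_add_cos_sq α
    rw [h3, pow_one, pow_one, hM']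
    simp [Matrix.mulVec, dotProduct, Fin.sum_univ_two]
    linear_combination Complex.cos α * c * hw + Complex.cos α * c * (w - 1) * hsc
  | more n ih0 ih1 =>
    have hpow : M ^ (n + 2) =
        (2 * w * Complex.cos (2 * α)) • M ^ (n + 1) - w ^ 2 • M ^ n := by
      rw [pow_add, pow_two M, hsq, mul_sub, Matrix.mul_smul, Matrix.mul_smul, mul_one, pow_succ M]
    have hrec : Complex.cos ((2 * (n + 2 : ℕ) + 1) * α) =
        2 * Complex.cos (2 * α) * Complex.cos ((2 * (n + 1 : ℕ) + 1) * α) -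
          Complex.cos ((2 * n + 1) * α) := by
      have e1 : (2 * ((n + 2 : ℕ) : ℂ) + 1) * α = (2 * (n + 1 : ℕ) + 1) * α + 2 * α := by
        push_cast; ring
      have e2 : (2 * (n : ℂ) + 1) * α = (2 * (n + 1 : ℕ) + 1) * α - 2 * α := by
        push_cast; ring
      rw [e1, e2, Complex.cos_add, Complex.cos_sub]
      ring
    rw [hpow, hrec, Matrix.sub_mulVec, Matrix.smul_mulVec, Matrix.smul_mulVec]
    simp only [Pi.sub_apply, Pi.smul_apply, smul_eq_mul]
    linear_combination 2 * w * Complex.cos (2 * α) * ih1 - w ^ 2 * ih0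

theorem stmt_1 (p : ℝ) (hp0 : 0 < p) (hp1 : p ≤ 1)
    (θ : ℝ) (hθ : θ = Real.arcsin (Real.sqrt p))
    (J : ℕ) (hJ : (J : ℤ) = ⌊π / (4 * θ) - 1 / 2⌋)
    (φ : ℝ) (hφ : φ = 2 * Real.arcsin (Real.sin (π / (4 * J + 6)) / Real.sqrt p))
    (ψ : Fin 2 → ℂ) (hψ : ψ = ![(Real.sin θ : ℂ), (Real.cos θ : ℂ)])
    (E₀ : Matrix (Fin 2) (Fin 2) ℂ) (hE₀ : E₀ = !![1, 0; 0, 0])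
    (M : Matrix (Fin 2) (Fin 2) ℂ)
    (hM : M = (1 + (Complex.exp (Complex.I * φ) - 1) • Matrix.vecMulVec ψ (star ψ)) *
      (1 + (Complex.exp (Complex.I * φ) - 1) • E₀)) :
    ((M ^ (J + 1)).mulVec ψ) 1 = 0 := by
  have hsp : 0 < √p := Real.sqrt_pos.mpr hp0
  have hsin : Real.sin θ = √p := by
    rw [hθ, Real.sin_arcsin (by linarith) (Real.sqrt_le_one.mpr hp1)]
  have hθ0 : 0 < θ := hθ ▸ Real.arcsin_pos.mpr hsp
  have hθ1 : θ ≤ π / 2 := hθ ▸ Real.arcsin_le_pi_div_two _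
  have hJ0 : (0 : ℝ) ≤ J := J.cast_nonneg
  set α : ℝ := π / (4 * J + 6) with hα
  have hαmul : α * (4 * J + 6) = π := div_mul_cancel₀ _ (by positivity)
  have hα0 : 0 < α := by positivity
  have hαθ : α ≤ θ := by
    have hlt : π / (4 * θ) - 1 / 2 < (J : ℝ) + 1 := by
      have := Int.lt_floor_add_one (π / (4 * θ) - 1 / 2)
      rw [← hJ] at this
      exact_mod_cast this
    have hlt' : π / (4 * θ) < J + 3 / 2 := by linarith
    rw [div_lt_iff₀ (by positivity)] at hlt'
    rw [hα, div_le_iff₀ (by positivity)]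
    linarith
  have hα1 : α < π / 2 := by nlinarith
  have hsinα : 0 < Real.sin α := Real.sin_pos_of_pos_of_lt_pi hα0 (by linarith)
  have hle : Real.sin α ≤ √p :=
    hsin ▸ Real.sin_le_sin_of_le_of_le_pi_div_two (by linarith) hθ1 hαθ
  have hphase : Real.sin (φ / 2) * Real.sin θ = Real.sin α := by
    rw [hφ, mul_div_cancel_left₀ _ two_ne_zero,
      Real.sin_arcsin (by linarith [div_pos hsinα hsp]) ((div_le_one hsp).mpr hle), hsin,
      div_mul_cancel₀ _ hsp.ne']
  have hstar : star ψ = ![(Real.sin θ : ℂ), (Real.cos θ : ℂ)] := by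
    rw [hψ]
    ext i
    fin_cases i <;> simp only [Pi.star_apply] <;> exact Complex.conj_ofReal _
  have hw := exp_sub_one_sq_mul_sq hphase
  rw [Complex.ofReal_sin α] at hw
  rw [hstar, hE₀, hψ] at hM
  have key := cos_mul_pow_mulVec_one (by exact_mod_cast Real.sin_sq_add_cos_sq θ) hw hM (J + 1)
  have hzero : Complex.cos ((2 * (J + 1 : ℕ) + 1) * (α : ℂ)) = 0 := by
    have : (2 * ((J + 1 : ℕ) : ℂ) + 1) * (α : ℂ) = ((π / 2 : ℝ) : ℂ) := by
      rw [← hαmul]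
      push_cast
      ring
    rw [this, ← Complex.ofReal_cos, Real.cos_pi_div_two, Complex.ofReal_zero]
  have hne : Complex.cos (α : ℂ) ≠ 0 := by
    rw [← Complex.ofReal_cos]
    exact_mod_cast (Real.cos_pos_of_mem_Ioo ⟨by linarith, hα1⟩).ne'
  rw [hzero, mul_zero] at key
  rw [hψ]
  exact (mul_eq_zero.mp key).resolve_left hne
end

section
/- Let θ, φ ∈ ℝ with cos θ ≠ 0, set β = arcsin( sin(φ/2) · sin θ ), and assume cos β ≠ 0. Let ψ : Fin 2 → ℂ be the vector (sin θ, cos θ), let E₀ be the 2×2 matrix with (0,0)-entry 1 and all other entries 0, and define M = (1 + (exp(iφ) − 1) • vecMulVec ψ (star ψ)) · (1 + (exp(iφ) − 1) • E₀). Let X = !![0,1;1,0], Y = !![0,−i;i,0], Z = !![1,0;0,−1] be the Pauli matrices, and set n_x = (cos θ / cos β)·cos(φ/2), n_y = (cos θ / cos β)·sin(φ/2), n_z = (cos θ / cos β)·cos(φ/2)·tan θ. Then M = exp(iφ) · ( cos(2β) • 1 + (i · sin(2β)) • (n_x • X + n_y • Y + n_z • Z) ). -/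
open Real Matrix

theorem stmt_2 (θ φ : ℝ) (hcosθ : Real.cos θ ≠ 0)
    (β : ℝ) (hβ : β = Real.arcsin (Real.sin (φ / 2) * Real.sin θ))
    (hcosβ : Real.cos β ≠ 0)
    (ψ : Fin 2 → ℂ) (hψ : ψ = ![(Real.sin θ : ℂ), (Real.cos θ : ℂ)])
    (E₀ : Matrix (Fin 2) (Fin 2) ℂ) (hE₀ : E₀ = !![1, 0; 0, 0])
    (M : Matrix (Fin 2) (Fin 2) ℂ)
    (hM : M = (1 + (Complex.exp (Complex.I * φ) - 1) • Matrix.vecMulVec ψ (star ψ)) *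
      (1 + (Complex.exp (Complex.I * φ) - 1) • E₀))
    (X Y Z : Matrix (Fin 2) (Fin 2) ℂ)
    (hX : X = !![0, 1; 1, 0])
    (hY : Y = !![0, -Complex.I; Complex.I, 0])
    (hZ : Z = !![1, 0; 0, -1])
    (nx ny nz : ℝ)
    (hnx : nx = (Real.cos θ / Real.cos β) * Real.cos (φ / 2))
    (hny : ny = (Real.cos θ / Real.cos β) * Real.sin (φ / 2))
    (hnz : nz = (Real.cos θ / Real.cos β) * Real.cos (φ / 2) * Real.tan θ) :
    M = Complex.exp (Complex.I * φ) •
      (Real.cos (2 * β) • (1 : Matrix (Fin 2) (Fin 2) ℂ) +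
        (Complex.I * Real.sin (2 * β)) • (nx • X + ny • Y + nz • Z)) := by
  have hsin : Real.sin β = Real.sin (φ / 2) * Real.sin θ := by
    have hle : |Real.sin (φ / 2) * Real.sin θ| ≤ 1 := by
      rw [abs_mul]
      exact mul_le_one₀ (Real.abs_sin_le_one _) (abs_nonneg _) (Real.abs_sin_le_one _)
    rw [hβ, Real.sin_arcsin (abs_le.1 hle).1 (abs_le.1 hle).2]
  have hx : Real.sin (2 * β) * nx =
      2 * Real.sin (φ / 2) * Real.sin θ * Real.cos θ * Real.cos (φ / 2) := by
    rw [Real.sin_two_mul, hnx, hsin]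
    field_simp
  have hy : Real.sin (2 * β) * ny = 2 * Real.sin (φ / 2) ^ 2 * Real.sin θ * Real.cos θ := by
    rw [Real.sin_two_mul, hny, hsin]
    field_simp
  have hz : Real.sin (2 * β) * nz =
      2 * Real.sin (φ / 2) * Real.sin θ ^ 2 * Real.cos (φ / 2) := by
    rw [Real.sin_two_mul, hnz, hsin, Real.tan_eq_sin_div_cos]
    field_simp
  have hc : Real.cos (2 * β) = 1 - 2 * (Real.sin (φ / 2) * Real.sin θ) ^ 2 := by
    rw [Real.cos_two_mul, Real.cos_sq', hsin]
    ring
  have hexp : Complex.exp (Complex.I * φ) =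
      ((Real.cos (φ / 2) : ℂ) + Real.sin (φ / 2) * Complex.I) ^ 2 := by
    rw [Complex.ofReal_cos, Complex.ofReal_sin, Complex.cos_add_sin_I, ← Complex.exp_nat_mul]
    congr 1
    push_cast
    ring
  have hφ : (Real.cos (φ / 2) : ℂ) ^ 2 = 1 - (Real.sin (φ / 2) : ℂ) ^ 2 := by
    exact_mod_cast Real.cos_sq' (φ / 2)
  have hθ : (Real.cos θ : ℂ) ^ 2 = 1 - (Real.sin θ : ℂ) ^ 2 := by
    exact_mod_cast Real.cos_sq' θ
  have hI := Complex.I_sq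
  replace hx := congrArg Complex.ofReal hx
  replace hy := congrArg Complex.ofReal hy
  replace hz := congrArg Complex.ofReal hz
  replace hc := congrArg Complex.ofReal hc
  simp only [Complex.ofReal_mul, Complex.ofReal_sub, Complex.ofReal_pow, Complex.ofReal_one,
    Complex.ofReal_ofNat] at hx hy hz hc
  subst hM hψ hE₀ hX hY hZ
  have hP : Matrix.vecMulVec ![(Real.sin θ : ℂ), (Real.cos θ : ℂ)]
      (star ![(Real.sin θ : ℂ), (Real.cos θ : ℂ)]) =
      !![(Real.sin θ : ℂ) * Real.sin θ, (Real.sin θ : ℂ) * Real.cos θ;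
        (Real.cos θ : ℂ) * Real.sin θ, (Real.cos θ : ℂ) * Real.cos θ] := by
    ext i j
    fin_cases i <;> fin_cases j <;>
      simp [Matrix.vecMulVec, -Complex.ofReal_sin, -Complex.ofReal_cos]
  rw [hexp, hP]
  clear hexp hP hβ hcosβ hcosθ hnx hny hnz hsin
  generalize Real.cos (2 * β) = C at *
  generalize Real.sin (2 * β) = S at *
  generalize Real.cos (φ / 2) = c at *
  generalize Real.sin (φ / 2) = s at *
  generalize Real.cos θ = b at *
  generalize Real.sin θ = a at *
  generalize he : ((c : ℂ) + s * Complex.I) ^ 2 = e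
  have hunit : ((c : ℂ) + s * Complex.I) * (c - s * Complex.I) = 1 := by
    linear_combination hφ - (s : ℂ) ^ 2 * hI
  have hE : e = 1 - 2 * (s : ℂ) ^ 2 + 2 * c * s * Complex.I := by
    linear_combination hφ + (s : ℂ) ^ 2 * hI - he
  have hhalf : e * (c - s * Complex.I) = c + s * Complex.I := by
    linear_combination -(c - s * Complex.I) * he + (c + s * Complex.I) * hunit
  have hinv : e * (1 - 2 * (s : ℂ) ^ 2 - 2 * c * s * Complex.I) = 1 := by
    linear_combination (c - s * Complex.I) * hhalf + hunit - e * (hφ + (s : ℂ) ^ 2 * hI)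
  ext i j
  fin_cases i <;> fin_cases j <;> simp [Matrix.mul_apply, Fin.sum_univ_two]
  · linear_combination e * a ^ 2 * hE - e * hc - e * Complex.I * hz
  · linear_combination a * b * hE - e * Complex.I * hx - e * hy
      - 2 * s * a * b * Complex.I * hhalf
      + (e * S * ny - 2 * (s : ℂ) ^ 2 * a * b * (e + 1)) * hI
  · linear_combination e * a * b * hE - e * Complex.I * hx - e * Complex.I ^ 2 * hy
      - 2 * (s : ℂ) ^ 2 * a * b * e * hI
  · linear_combination (e - 1) * hθ - e * hc + e * Complex.I * hz - a ^ 2 * hinv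
end

section
/- Let ι be a finite nonempty type with a distinguished element x₀, let A be a unitary matrix over ℂ indexed by ι, and let ψ = A *ᵥ e_{x₀}. Let X be a finite set of elements of ι, set p = ∑_{x ∈ X} ‖ψ x‖² and θ = arcsin(√p). Define S_f = diagonal(x ↦ if x ∈ X then −1 else 1), S₀ = diagonal(x ↦ if x = x₀ then −1 else 1), and Q = A · S₀ · Aᴴ · S_f. Then for every natural number k, ∑_{x ∈ X} ‖(Q^k *ᵥ ψ) x‖² = ( sin((2k+1)·θ) )². -/
open Real Matrix Finset

theorem diagonal_ite_neg_one_eq {ι : Type*} [DecidableEq ι] (x₀ : ι) :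
    (Matrix.diagonal (fun x => if x = x₀ then -1 else 1) : Matrix ι ι ℂ) =
      1 - (2 : ℂ) • vecMulVec (Pi.single x₀ 1) (star (Pi.single x₀ 1)) := by
  ext i j
  by_cases hij : i = j <;> by_cases hi : i = x₀ <;> by_cases hj : j = x₀ <;>
    simp_all [vecMulVec_apply]
  norm_num

/-- Conjugating the sign flip at `x₀` by a unitary `A` gives the reflection along `A e_{x₀}`. -/
theorem unitary_conj_sign_flip {ι : Type*} [Fintype ι] [DecidableEq ι] (x₀ : ι)
    {A : Matrix ι ι ℂ} (hA : A ∈ Matrix.unitaryGroup ι ℂ) :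
    A * Matrix.diagonal (fun x => if x = x₀ then -1 else 1) * Aᴴ =
      1 - (2 : ℂ) • vecMulVec (A *ᵥ Pi.single x₀ 1) (star (A *ᵥ Pi.single x₀ 1)) := by
  have h : A * Aᴴ = 1 := Matrix.mem_unitaryGroup_iff.mp hA
  rw [diagonal_ite_neg_one_eq, Matrix.mul_sub, Matrix.sub_mul, mul_one, h, Matrix.mul_smul,
    Matrix.smul_mul, mul_vecMulVec, vecMulVec_mul, star_mulVec]

theorem sum_norm_sq_unitary_mulVec_single {ι : Type*} [Fintype ι] [DecidableEq ι] (x₀ : ι)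
    {A : Matrix ι ι ℂ} (hA : A ∈ Matrix.unitaryGroup ι ℂ) :
    ∑ x, ‖(A *ᵥ Pi.single x₀ 1) x‖ ^ 2 = 1 := by
  have h : Aᴴ * A = 1 := Matrix.mem_unitaryGroup_iff'.mp hA
  have h1 := congrFun (congrFun h x₀) x₀
  simp only [Matrix.mul_apply, Matrix.conjTranspose_apply, Matrix.one_apply_eq] at h1
  have h2 : ((∑ x, ‖A x x₀‖ ^ 2 : ℝ) : ℂ) = 1 := by
    rw [← h1]
    push_cast
    exact Finset.sum_congr rfl fun x _ => (Complex.conj_mul' _).symm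
  simpa using Complex.ofReal_injective (by simpa using h2)

/-- One amplification step on a vector that is a multiple of `ψ` on `X` and another on `Xᶜ`. -/
theorem reflection_mul_sign_flip_mulVec {ι : Type*} [Fintype ι] [DecidableEq ι]
    {ψ : ι → ℂ} (X : Finset ι) {p : ℝ} (hp : p = ∑ x ∈ X, ‖ψ x‖ ^ 2)
    (hψ : ∑ x, ‖ψ x‖ ^ 2 = 1) (a b : ℝ) :
    ((1 - (2 : ℂ) • vecMulVec ψ (star ψ)) *
        Matrix.diagonal (fun x => if x ∈ X then -1 else 1)) *ᵥ
        (fun x => ((if x ∈ X then a else b : ℝ) : ℂ) * ψ x) =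
      fun x => ((if x ∈ X then -a + 2 * (a * p - b * (1 - p))
        else b + 2 * (a * p - b * (1 - p)) : ℝ) : ℂ) * ψ x := by
  have hc : ∑ x ∈ Xᶜ, ‖ψ x‖ ^ 2 = 1 - p := by
    rw [hp, ← hψ, ← Finset.sum_add_sum_compl X]; ring
  have hd : star ψ ⬝ᵥ (Matrix.diagonal (fun x => if x ∈ X then (-1 : ℂ) else 1) *ᵥ
      (fun x => ((if x ∈ X then a else b : ℝ) : ℂ) * ψ x)) =
      ((-(a * p) + b * (1 - p) : ℝ) : ℂ) := by
    rw [← hc, hp, Finset.mul_sum, Finset.mul_sum, ← Finset.sum_neg_distrib]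
    push_cast
    rw [dotProduct, ← Finset.sum_add_sum_compl X]
    congr 1 <;> refine Finset.sum_congr rfl fun x hx => ?_
    · simp only [Matrix.mulVec_diagonal, hx, if_true, Pi.star_apply]
      rw [← Complex.conj_mul', ← starRingEnd_apply]; ring
    · simp only [Matrix.mulVec_diagonal, Finset.mem_compl.mp hx, if_false, Pi.star_apply]
      rw [← Complex.conj_mul', ← starRingEnd_apply]; ring
  rw [← Matrix.mulVec_mulVec, Matrix.sub_mulVec, Matrix.one_mulVec, Matrix.smul_mulVec,
    vecMulVec_mulVec, hd]
  ext x
  by_cases hx : x ∈ X <;> simp [Matrix.mulVec_diagonal, hx] <;> ring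

theorem stmt_4 {ι : Type*} [Fintype ι] [DecidableEq ι] [Nonempty ι] (x₀ : ι)
    (A : Matrix ι ι ℂ) (hA : A ∈ Matrix.unitaryGroup ι ℂ)
    (ψ : ι → ℂ) (hψ : ψ = A.mulVec (Pi.single x₀ 1))
    (X : Finset ι) (p : ℝ) (hp : p = ∑ x ∈ X, ‖ψ x‖ ^ 2)
    (θ : ℝ) (hθ : θ = Real.arcsin (Real.sqrt p))
    (Sf S₀ Q : Matrix ι ι ℂ)
    (hSf : Sf = Matrix.diagonal (fun x => if x ∈ X then -1 else 1))
    (hS₀ : S₀ = Matrix.diagonal (fun x => if x = x₀ then -1 else 1))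
    (hQ : Q = A * S₀ * Aᴴ * Sf) :
    ∀ k : ℕ, ∑ x ∈ X, ‖((Q ^ k).mulVec ψ) x‖ ^ 2 = (Real.sin ((2 * k + 1) * θ)) ^ 2 := by
  have hn : ∑ x, ‖ψ x‖ ^ 2 = 1 := hψ ▸ sum_norm_sq_unitary_mulVec_single x₀ hA
  have hp0 : 0 ≤ p := hp ▸ Finset.sum_nonneg fun x _ => sq_nonneg _
  have hp1 : p ≤ 1 := by
    rw [hp, ← hn]
    exact Finset.sum_le_sum_of_subset_of_nonneg (Finset.subset_univ X) fun x _ _ => sq_nonneg _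
  have hs : Real.sin θ ^ 2 = p := by
    rw [hθ, Real.sin_arcsin (by linarith [Real.sqrt_nonneg p]) (Real.sqrt_le_one.mpr hp1),
      Real.sq_sqrt hp0]
  have hc : Real.cos θ ^ 2 = 1 - p := by rw [Real.cos_sq', hs]
  have key : ∀ k : ℕ, ∃ a b : ℝ,
      (Q ^ k) *ᵥ ψ = (fun x => ((if x ∈ X then a else b : ℝ) : ℂ) * ψ x) ∧
      a * Real.sin θ = (-1) ^ k * Real.sin ((2 * k + 1) * θ) ∧
      b * Real.cos θ = (-1) ^ k * Real.cos ((2 * k + 1) * θ) := by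
    intro k
    induction k with
    | zero => exact ⟨1, 1, by simp, by simp, by simp⟩
    | succ k ih =>
      obtain ⟨a, b, hv, ha, hb⟩ := ih
      have hang : (2 * ((k + 1 : ℕ) : ℝ) + 1) * θ = (2 * k + 1) * θ + 2 * θ := by
        push_cast; ring
      refine ⟨-a + 2 * (a * p - b * (1 - p)), b + 2 * (a * p - b * (1 - p)), ?_, ?_, ?_⟩
      · rw [pow_succ', ← Matrix.mulVec_mulVec, hv, hQ, hS₀, hSf, unitary_conj_sign_flip x₀ hA,
          ← hψ, reflection_mul_sign_flip_mulVec X hp hn]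
      · rw [hang, Real.sin_add, Real.sin_two_mul, Real.cos_two_mul, ← hc, pow_succ]
        linear_combination (1 - 2 * Real.cos θ ^ 2) * ha
          - 2 * Real.sin θ * Real.cos θ * hb
          + 2 * a * Real.sin θ * hc
      · rw [hang, Real.cos_add, Real.sin_two_mul, Real.cos_two_mul, ← hc, pow_succ]
        linear_combination (1 - 2 * Real.cos θ ^ 2) * hb
          + 2 * Real.sin θ * Real.cos θ * ha
          - 2 * a * Real.cos θ * hs
  intro k
  obtain ⟨a, b, hv, ha, -⟩ := key k
  have hsq : Real.sin ((2 * k + 1) * θ) ^ 2 = a ^ 2 * p := by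
    rw [← hs, ← mul_pow, ha, mul_pow, ← pow_mul, mul_comm k, pow_mul]
    norm_num
  rw [hsq, hp, Finset.mul_sum, hv]
  refine Finset.sum_congr rfl fun x hx => ?_
  simp [hx, mul_pow]
end

section
/- Let p ∈ ℝ with 0 < p ≤ 1, set θ = arcsin(√p), and let r = ⌊π/(4θ)⌋. Then ( sin((2r+1)·θ) )² ≥ 1 − p. -/
open Real

theorem stmt_5 (p : ℝ) (hp0 : 0 < p) (hp1 : p ≤ 1)
    (θ : ℝ) (hθ : θ = Real.arcsin (Real.sqrt p))
    (r : ℕ) (hr : (r : ℤ) = ⌊π / (4 * θ)⌋) :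
    (Real.sin ((2 * r + 1) * θ)) ^ 2 ≥ 1 - p := by
  have hpos : 0 < θ := hθ ▸ Real.arcsin_pos.2 (Real.sqrt_pos.2 hp0)
  have hle : θ ≤ π / 2 := hθ ▸ Real.arcsin_le_pi_div_two _
  have hsin : Real.sin θ = √p := by
    rw [hθ, Real.sin_arcsin (by linarith [Real.sqrt_nonneg p]) (Real.sqrt_le_one.2 hp1)]
  have hcos_sq : Real.cos θ ^ 2 = 1 - p := by
    rw [Real.cos_sq', hsin, Real.sq_sqrt hp0.le]
  obtain ⟨hlo, hhi⟩ := Int.floor_eq_iff.1 hr.symm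
  push_cast at hlo hhi
  rw [le_div_iff₀ (by positivity)] at hlo
  rw [div_lt_iff₀ (by positivity)] at hhi
  have habs : |(2 * r + 1) * θ - π / 2| ≤ θ := abs_le.2 ⟨by linarith, by linarith⟩
  have hcos : Real.cos θ ≤ Real.sin ((2 * r + 1) * θ) := by
    rw [← Real.cos_sub_pi_div_two, ← Real.cos_abs (_ - _)]
    exact Real.cos_le_cos_of_nonneg_of_le_pi (abs_nonneg _) (by linarith) habs
  have hcos_nonneg : 0 ≤ Real.cos θ := Real.cos_nonneg_of_mem_Icc ⟨by linarith, hle⟩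
  rw [← hcos_sq]
  gcongr
end

section
/- Let ι be a finite nonempty type with a distinguished element x₀, let A be a unitary matrix over ℂ indexed by ι, and let ψ = A *ᵥ e_{x₀}. Let X be a finite set of elements of ι, set p = ∑_{x ∈ X} ‖ψ x‖², and assume 0 < p. Define S_f = diagonal(x ↦ if x ∈ X then −1 else 1), S₀ = diagonal(x ↦ if x = x₀ then −1 else 1), Q = A · S₀ · Aᴴ · S_f, and let r = ⌊π/(4·arcsin(√p))⌋ (a nonnegative integer). Then ∑_{x ∈ X} ‖(Q^r *ᵥ ψ) x‖² ≥ 1 − p. -/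
open Real Matrix Finset

/-- Conjugating the sign flip at `x₀` by a unitary matrix gives the reflection along
the column indexed by `x₀`. -/
lemma unitary_conj_flip_mulVec {ι : Type*} [Fintype ι] [DecidableEq ι] (x₀ : ι)
    (A : Matrix ι ι ℂ) (hA : A ∈ Matrix.unitaryGroup ι ℂ) (w : ι → ℂ) :
    (A * Matrix.diagonal (fun x => if x = x₀ then -1 else 1) * Aᴴ).mulVec w =
      w - (2 * ∑ y, star (A y x₀) * w y) • A.mulVec (Pi.single x₀ 1) := by
  have hd : ∀ v : ι → ℂ, (Matrix.diagonal (fun x => if x = x₀ then (-1 : ℂ) else 1)).mulVec v =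
      v - (2 * v x₀) • Pi.single x₀ 1 := by
    intro v
    ext x
    rw [Matrix.mulVec_diagonal]
    by_cases h : x = x₀
    · subst h
      simp
      ring
    · simp [h]
  have hAA : A * Aᴴ = 1 := Matrix.mem_unitaryGroup_iff.mp hA
  rw [← Matrix.mulVec_mulVec, ← Matrix.mulVec_mulVec, hd, Matrix.mulVec_sub,
    Matrix.mulVec_smul, Matrix.mulVec_mulVec, hAA, Matrix.one_mulVec]
  rfl

lemma sum_norm_sq_col_of_mem_unitaryGroup {ι : Type*} [Fintype ι] [DecidableEq ι]
    (A : Matrix ι ι ℂ) (hA : A ∈ Matrix.unitaryGroup ι ℂ) (x₀ : ι) :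
    ∑ x, ‖A x x₀‖ ^ 2 = 1 := by
  have h : (Aᴴ * A) x₀ x₀ = 1 := by
    rw [← Matrix.star_eq_conjTranspose, Matrix.mem_unitaryGroup_iff'.mp hA, Matrix.one_apply_eq]
  rw [Matrix.mul_apply] at h
  have h2 : ((∑ x, ‖A x x₀‖ ^ 2 : ℝ) : ℂ) = 1 := by
    rw [← h]
    push_cast
    refine Finset.sum_congr rfl fun x _ => ?_
    rw [Matrix.conjTranspose_apply, ← Complex.conj_mul']
    rfl
  exact_mod_cast h2

/-- The overlap of `ψ` with the vector obtained from `ψ` by scaling its part on `X` by `a` and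
its remaining part by `b`. -/
lemma sum_star_mul_ite_mul {ι : Type*} [Fintype ι] [DecidableEq ι] (ψ : ι → ℂ)
    (hψ : ∑ x, ‖ψ x‖ ^ 2 = 1) (X : Finset ι) (a b : ℂ) :
    ∑ y, star (ψ y) * ((if y ∈ X then a else b) * ψ y) =
      a * ((∑ x ∈ X, ‖ψ x‖ ^ 2 : ℝ) : ℂ) + b * ((1 - ∑ x ∈ X, ‖ψ x‖ ^ 2 : ℝ) : ℂ) := by
  have hc : 1 - ∑ x ∈ X, ‖ψ x‖ ^ 2 = ∑ x ∈ Xᶜ, ‖ψ x‖ ^ 2 := by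
    rw [← hψ, ← Finset.sum_add_sum_compl X]
    ring
  have hs : ∀ y, star (ψ y) * ψ y = ((‖ψ y‖ ^ 2 : ℝ) : ℂ) := by
    intro y
    push_cast
    exact Complex.conj_mul' _
  rw [hc, ← Finset.sum_add_sum_compl X]
  push_cast
  rw [Finset.mul_sum, Finset.mul_sum]
  congr 1
  · refine Finset.sum_congr rfl fun y hy => ?_
    have := hs y
    push_cast at this
    rw [if_pos hy, ← this]
    ring
  · refine Finset.sum_congr rfl fun y hy => ?_
    have := hs y
    push_cast at this
    rw [if_neg (Finset.mem_compl.mp hy), ← this]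
    ring

/-- Amplitude amplification acts as a rotation by `2 * θ` in the plane spanned by the parts of `ψ`
on and off `X`, up to sign. -/
lemma amplification_pow_mulVec_s6 {ι : Type*} [Fintype ι] [DecidableEq ι] (x₀ : ι)
    (A : Matrix ι ι ℂ) (hA : A ∈ Matrix.unitaryGroup ι ℂ)
    (ψ : ι → ℂ) (hψ : ψ = A.mulVec (Pi.single x₀ 1)) (X : Finset ι) (θ : ℝ)
    (hθ : sin θ ^ 2 = ∑ x ∈ X, ‖ψ x‖ ^ 2) (n : ℕ) :
    ∃ a b : ℝ, a * sin θ = sin ((2 * n + 1) * θ) ∧ b * cos θ = cos ((2 * n + 1) * θ) ∧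
      ∀ x, (((A * Matrix.diagonal (fun x => if x = x₀ then -1 else 1) * Aᴴ *
        Matrix.diagonal (fun x => if x ∈ X then -1 else 1)) ^ n).mulVec ψ) x =
          (-1) ^ n * ((if x ∈ X then (a : ℂ) else b) * ψ x) := by
  have hcol : ∀ x, ψ x = A x x₀ := by
    intro x
    simp [hψ]
  have h1 : ∑ x, ‖ψ x‖ ^ 2 = 1 := by
    simp only [hcol]
    exact sum_norm_sq_col_of_mem_unitaryGroup A hA x₀
  induction n with
  | zero => exact ⟨1, 1, by simp, by simp, by simp⟩
  | succ n ih =>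
    obtain ⟨a, b, ha, hb, hv⟩ := ih
    have hang : (2 * ((n + 1 : ℕ) : ℝ) + 1) * θ = (2 * n + 1) * θ + 2 * θ := by
      push_cast
      ring
    have hcos : cos (2 * θ) = 1 - 2 * sin θ ^ 2 := by
      rw [cos_two_mul, cos_sq']
      ring
    refine ⟨a * (1 - 2 * sin θ ^ 2) + 2 * (1 - sin θ ^ 2) * b,
      b * (1 - 2 * sin θ ^ 2) - 2 * sin θ ^ 2 * a, ?_, ?_, fun x => ?_⟩
    · rw [hang, sin_add, ← ha, ← hb, hcos, sin_two_mul, ← cos_sq']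
      ring
    · rw [hang, cos_add, ← ha, ← hb, hcos, sin_two_mul]
      ring
    · have hw : (Matrix.diagonal (fun x => if x ∈ X then (-1 : ℂ) else 1)).mulVec
          (fun x => (-1) ^ n * ((if x ∈ X then (a : ℂ) else b) * ψ x)) =
          fun x => (if x ∈ X then (-1) ^ n * -(a : ℂ) else (-1) ^ n * b) * ψ x := by
        ext y
        rw [Matrix.mulVec_diagonal]
        split_ifs <;> ring
      rw [pow_succ', ← Matrix.mulVec_mulVec, funext hv, ← Matrix.mulVec_mulVec, hw,
        unitary_conj_flip_mulVec x₀ A hA, ← hψ]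
      simp only [← hcol, Pi.sub_apply, Pi.smul_apply, smul_eq_mul]
      rw [sum_star_mul_ite_mul ψ h1, ← hθ]
      push_cast
      split_ifs <;> ring

/-- The odd multiple of `θ` closest to `π / 2` is within `θ` of it. -/
lemma cos_sq_le_sin_sq_of_floor {θ : ℝ} (h0 : 0 < θ) (h1 : θ ≤ π / 2) (r : ℕ)
    (hr : (r : ℤ) = ⌊π / (4 * θ)⌋) : cos θ ^ 2 ≤ sin ((2 * r + 1) * θ) ^ 2 := by
  obtain ⟨hle, hlt⟩ := Int.floor_eq_iff.mp hr.symm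
  push_cast at hle hlt
  rw [le_div_iff₀ (by positivity)] at hle
  rw [div_lt_iff₀ (by positivity)] at hlt
  have habs : |(2 * r + 1) * θ - π / 2| ≤ θ := by
    rw [abs_le]
    constructor <;> linarith
  have hcos : cos θ ≤ sin ((2 * r + 1) * θ) := by
    rw [← cos_sub_pi_div_two, ← cos_abs ((2 * r + 1) * θ - π / 2)]
    exact cos_le_cos_of_nonneg_of_le_pi (abs_nonneg _) (by linarith [pi_pos]) habs
  exact pow_le_pow_left₀ (cos_nonneg_of_neg_pi_div_two_le_of_le (by linarith) h1) hcos 2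

theorem stmt_6 {ι : Type*} [Fintype ι] [DecidableEq ι] [Nonempty ι] (x₀ : ι)
    (A : Matrix ι ι ℂ) (hA : A ∈ Matrix.unitaryGroup ι ℂ)
    (ψ : ι → ℂ) (hψ : ψ = A.mulVec (Pi.single x₀ 1))
    (X : Finset ι) (p : ℝ) (hp : p = ∑ x ∈ X, ‖ψ x‖ ^ 2) (hp0 : 0 < p)
    (Sf S₀ Q : Matrix ι ι ℂ)
    (hSf : Sf = Matrix.diagonal (fun x => if x ∈ X then -1 else 1))
    (hS₀ : S₀ = Matrix.diagonal (fun x => if x = x₀ then -1 else 1))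
    (hQ : Q = A * S₀ * Aᴴ * Sf)
    (r : ℕ) (hr : (r : ℤ) = ⌊π / (4 * Real.arcsin (Real.sqrt p))⌋) :
    ∑ x ∈ X, ‖((Q ^ r).mulVec ψ) x‖ ^ 2 ≥ 1 - p := by
  have hp1 : p ≤ 1 := by
    rw [hp, ← sum_norm_sq_col_of_mem_unitaryGroup A hA x₀]
    refine (Finset.sum_le_univ_sum_of_nonneg fun x => by positivity).trans_eq ?_
    simp [hψ]
  set θ := Real.arcsin (Real.sqrt p) with hθ
  have hsin : sin θ ^ 2 = p := by
    rw [hθ, sin_arcsin (by linarith [Real.sqrt_nonneg p]) (Real.sqrt_le_one.mpr hp1),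
      Real.sq_sqrt hp0.le]
  have hθ0 : 0 < θ := Real.arcsin_pos.mpr (Real.sqrt_pos.mpr hp0)
  obtain ⟨a, b, ha, -, hv⟩ :=
    amplification_pow_mulVec_s6 x₀ A hA ψ hψ X θ (hsin.trans hp) r
  have hsum : ∑ x ∈ X, ‖((Q ^ r).mulVec ψ) x‖ ^ 2 = sin ((2 * r + 1) * θ) ^ 2 := by
    rw [← ha, mul_pow, hsin, hp, Finset.mul_sum]
    refine Finset.sum_congr rfl fun x hx => ?_
    rw [hQ, hS₀, hSf, hv, if_pos hx]
    simp [mul_pow]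
  rw [hsum, ← hsin, ← cos_sq']
  exact cos_sq_le_sin_sq_of_floor hθ0 (Real.arcsin_le_pi_div_two _) r hr
end

section
/- Let θ ∈ ℝ and let R = !![cos(2θ), sin(2θ); −sin(2θ), cos(2θ)] be the 2×2 rotation matrix by angle 2θ. Then for every natural number k, R^k *ᵥ ![sin θ, cos θ] = ![sin((2k+1)·θ), cos((2k+1)·θ)]. -/
open Real Matrix

theorem stmt_8 (θ : ℝ)
    (R : Matrix (Fin 2) (Fin 2) ℝ)
    (hR : R = !![Real.cos (2 * θ), Real.sin (2 * θ); -Real.sin (2 * θ), Real.cos (2 * θ)]) :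
    ∀ k : ℕ, (R ^ k).mulVec ![Real.sin θ, Real.cos θ] =
      ![Real.sin ((2 * k + 1) * θ), Real.cos ((2 * k + 1) * θ)] := by
  intro k
  induction k with
  | zero => simp
  | succ k ih =>
    have h : (2 * ((k + 1 : ℕ) : ℝ) + 1) * θ = (2 * k + 1) * θ + 2 * θ := by
      push_cast
      ring
    rw [pow_succ', ← Matrix.mulVec_mulVec, ih, hR, h, Real.sin_add, Real.cos_add]
    ext i
    fin_cases i <;> simp [Matrix.mulVec, dotProduct, Fin.sum_univ_two] <;> ring
end

section
/- Let p ∈ ℝ with 0 < p ≤ 1 and set θ = arcsin(√p). Then π/(4θ) − 1/2 ≥ 0, so that J = ⌊π/(4θ) − 1/2⌋ is a nonnegative integer; moreover sin( π/(4·J + 6) ) ≤ √p, so that the quotient sin(π/(4J+6))/√p lies in [0,1] and the phase angle φ = 2·arcsin( sin(π/(4J+6)) / √p ) is well defined. -/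
open Real

theorem stmt_9 (p : ℝ) (hp0 : 0 < p) (hp1 : p ≤ 1)
    (θ : ℝ) (hθ : θ = Real.arcsin (Real.sqrt p)) :
    0 ≤ π / (4 * θ) - 1 / 2 ∧
    Real.sin (π / (4 * (⌊π / (4 * θ) - 1 / 2⌋ : ℝ) + 6)) ≤ Real.sqrt p ∧
    Real.sin (π / (4 * (⌊π / (4 * θ) - 1 / 2⌋ : ℝ) + 6)) / Real.sqrt p ∈ Set.Icc (0 : ℝ) 1 := by
  have hs : 0 < √p := Real.sqrt_pos.2 hp0
  have hs1 : √p ≤ 1 := Real.sqrt_le_one.2 hp1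
  have hθ0 : 0 < θ := hθ ▸ Real.arcsin_pos.2 hs
  have hθ1 : θ ≤ π / 2 := hθ ▸ Real.arcsin_le_pi_div_two _
  have hsin : Real.sin θ = √p := by
    rw [hθ, Real.sin_arcsin (by linarith) hs1]
  have h0 : 0 ≤ π / (4 * θ) - 1 / 2 := by
    rw [sub_nonneg, le_div_iff₀ (by positivity)]
    linarith
  have hJ0 : (0 : ℝ) ≤ (⌊π / (4 * θ) - 1 / 2⌋ : ℤ) := by
    exact_mod_cast Int.floor_nonneg.2 h0
  have hJ := Int.lt_floor_add_one (π / (4 * θ) - 1 / 2)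
  set J : ℝ := ((⌊π / (4 * θ) - 1 / 2⌋ : ℤ) : ℝ)
  have hangle : π / (4 * J + 6) ≤ θ := by
    have h : π / (4 * θ) < J + 3 / 2 := by linarith
    rw [div_lt_iff₀ (by positivity)] at h
    rw [div_le_iff₀ (by positivity)]
    linarith
  have hangle0 : 0 ≤ π / (4 * J + 6) := by positivity
  have hle : Real.sin (π / (4 * J + 6)) ≤ √p :=
    hsin ▸ Real.sin_le_sin_of_le_of_le_pi_div_two (by linarith [Real.pi_pos]) hθ1 hangle
  have hnonneg : 0 ≤ Real.sin (π / (4 * J + 6)) :=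
    Real.sin_nonneg_of_nonneg_of_le_pi hangle0 (by linarith [Real.pi_pos])
  exact ⟨h0, hle, div_nonneg hnonneg hs.le, div_le_one_of_le₀ hle hs.le⟩
end

section
/- Let p ∈ ℝ with 0 < p ≤ 1, set θ = arcsin(√p), let J = ⌊π/(4θ) − 1/2⌋ (a nonnegative integer), and let φ = 2·arcsin( sin(π/(4J+6)) / √p ). Then sin(φ/2)·√p = sin(π/(4J+6)), and the total rotation produced by J+1 iterations matches the required angle exactly: 4·(J+1)·arcsin( sin(φ/2)·√p ) = 2·( π/2 − arcsin( sin(φ/2)·√p ) ). -/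
open Real

theorem stmt_10 (p : ℝ) (hp0 : 0 < p) (hp1 : p ≤ 1)
    (θ : ℝ) (hθ : θ = Real.arcsin (Real.sqrt p))
    (J : ℕ) (hJ : (J : ℤ) = ⌊π / (4 * θ) - 1 / 2⌋)
    (φ : ℝ) (hφ : φ = 2 * Real.arcsin (Real.sin (π / (4 * J + 6)) / Real.sqrt p)) :
    Real.sin (φ / 2) * Real.sqrt p = Real.sin (π / (4 * J + 6)) ∧
    4 * (J + 1) * Real.arcsin (Real.sin (φ / 2) * Real.sqrt p) =
      2 * (π / 2 - Real.arcsin (Real.sin (φ / 2) * Real.sqrt p)) := by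
  have hs : 0 < √p := Real.sqrt_pos.2 hp0
  have hs1 : √p ≤ 1 := Real.sqrt_le_one.2 hp1
  have hθ0 : 0 < θ := hθ ▸ Real.arcsin_pos.2 hs
  have hθ2 : θ ≤ π / 2 := hθ ▸ Real.arcsin_le_pi_div_two _
  have hsinθ : Real.sin θ = √p := by
    rw [hθ, Real.sin_arcsin (by linarith) hs1]
  have hJ0 : (0 : ℝ) ≤ J := J.cast_nonneg
  have hden : (0 : ℝ) < 4 * J + 6 := by positivity
  have hfloor : π / (4 * θ) - 1 / 2 < (J : ℝ) + 1 := by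
    have h := Int.lt_floor_add_one (π / (4 * θ) - 1 / 2)
    rwa [← hJ, Int.cast_natCast] at h
  have hx0 : 0 < π / (4 * J + 6) := div_pos Real.pi_pos hden
  have hxθ : π / (4 * J + 6) ≤ θ := by
    have h : π / (4 * θ) < J + 3 / 2 := by linarith
    rw [div_lt_iff₀ (by positivity)] at h
    rw [div_le_iff₀ hden]
    linarith
  have hsin_le : Real.sin (π / (4 * J + 6)) ≤ √p :=
    hsinθ ▸ Real.sin_le_sin_of_le_of_le_pi_div_two (by linarith) hθ2 hxθ
  have hsin_nonneg : 0 ≤ Real.sin (π / (4 * J + 6)) :=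
    Real.sin_nonneg_of_nonneg_of_le_pi hx0.le (by linarith)
  have hmain : Real.sin (φ / 2) * √p = Real.sin (π / (4 * J + 6)) := by
    rw [hφ, mul_div_cancel_left₀ _ two_ne_zero, Real.sin_arcsin
      (by linarith [div_nonneg hsin_nonneg hs.le]) ((div_le_one hs).2 hsin_le),
      div_mul_cancel₀ _ hs.ne']
  refine ⟨hmain, ?_⟩
  rw [hmain, Real.arcsin_sin (by linarith) (by linarith)]
  field_simp
  ring
end
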